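/- Let S₁ = {(−1,−1,0), (−1,0,1), (−1,1,−1), (0,−1,1), (0,0,−1), (0,1,0), (1,0,0)} and let F(x,y,z;t) = Σ_{n≥0} (Σ_{i,j,k≥0} f_{S₁}(i,j,k;n) x^i y^j z^k) t^n, regarded as a formal power series in t with coefficients in ℚ[x,y,z]. Then F is D-finite in t: there exist r ≥ 0 and polynomials c_0, …, c_r ∈ ℚ[x,y,z,t], not all zero, such that Σ_{m=0}^{r} c_m · (d/dt)^m F = 0. -/

import Mathlib

noncomputable section

/-- The number of `S`-walks of length `n` in the octant that start at the
origin and end at the point `p`. -/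
def walkCount (S : Finset (Fin 3 → ℤ)) (p : Fin 3 → ℤ) (n : ℕ) : ℕ :=
  Set.ncard {w : List (Fin 3 → ℤ) |
    w.length = n ∧ (∀ s ∈ w, s ∈ S) ∧
    (∀ m : ℕ, ∀ c : Fin 3, 0 ≤ (w.take m).sum c) ∧ w.sum = p}

/-- The stepset `S₁`. -/
def S₁ : Finset (Fin 3 → ℤ) :=
  {![-1,-1,0], ![-1,0,1], ![-1,1,-1], ![0,-1,1], ![0,0,-1], ![0,1,0], ![1,0,0]}

/-- The generating function `F(x,y,z;t) = Σ_n (Σ_{i,j,k} f_{S₁}(i,j,k;n)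
x^i y^j z^k) t^n` of octant walks with steps from `S₁`, as a formal power
series in `t` with coefficients in `ℚ[x,y,z]`.  (Since `f(i,j,k;n) = 0`
unless `i,j,k ≤ n`, the inner sum may be truncated at `n`.) -/
def F : PowerSeries (MvPolynomial (Fin 3) ℚ) :=
  PowerSeries.mk fun n =>
    ∑ i ∈ Finset.range (n + 1), ∑ j ∈ Finset.range (n + 1),
      ∑ k ∈ Finset.range (n + 1),
        (walkCount S₁ ![(i : ℤ), (j : ℤ), (k : ℤ)] n : ℚ) •
          (MvPolynomial.X 0 ^ i * MvPolynomial.X 1 ^ j * MvPolynomial.X 2 ^ k)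

/-! ### Walks in the octant -/

/-- The set of walks counted by `walkCount`. -/
def octantWalks (S : Finset (Fin 3 → ℤ)) (p : Fin 3 → ℤ) (n : ℕ) : Set (List (Fin 3 → ℤ)) :=
  {w | w.length = n ∧ (∀ s ∈ w, s ∈ S) ∧
    (∀ m : ℕ, ∀ c : Fin 3, 0 ≤ (w.take m).sum c) ∧ w.sum = p}

lemma walkCount_eq_ncard (S : Finset (Fin 3 → ℤ)) (p : Fin 3 → ℤ) (n : ℕ) :
    walkCount S p n = (octantWalks S p n).ncard := rfl

lemma octantWalks_zero (S : Finset (Fin 3 → ℤ)) (p : Fin 3 → ℤ) :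
    octantWalks S p 0 = if p = 0 then {[]} else ∅ := by
  ext w
  by_cases hp : p = 0
  · subst hp
    simp only [octantWalks, List.length_eq_zero_iff, Set.mem_ofPred_eq, if_true,
      Set.mem_singleton_iff]
    constructor
    · exact fun h => h.1
    · rintro rfl
      simp
  · simp only [octantWalks, List.length_eq_zero_iff, Set.mem_ofPred_eq, if_neg hp,
      Set.mem_empty_iff_false, iff_false]
    rintro ⟨rfl, -, -, h⟩
    exact hp (by simpa using h.symm)

lemma octantWalks_eq_empty {S : Finset (Fin 3 → ℤ)} {p : Fin 3 → ℤ} (n : ℕ) {c : Fin 3}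
    (hp : p c < 0) : octantWalks S p n = ∅ := by
  ext w
  simp only [octantWalks, Set.mem_ofPred_eq, Set.mem_empty_iff_false, iff_false]
  rintro ⟨hl, -, h, rfl⟩
  have := h n c
  rw [← hl, List.take_length] at this
  omega

lemma octantWalks_succ {S : Finset (Fin 3 → ℤ)} {p : Fin 3 → ℤ} (n : ℕ) (hp : ∀ c, 0 ≤ p c) :
    octantWalks S p (n + 1) = ⋃ s ∈ S, (fun w => w ++ [s]) '' octantWalks S (p - s) n := by
  ext w
  simp only [Set.mem_iUnion, Set.mem_image, exists_prop]
  constructor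
  · rintro ⟨hl, hS, hpos, hsum⟩
    obtain ⟨v, s, rfl⟩ : ∃ v s, w = v ++ [s] := by
      have hw : w ≠ [] := by
        rintro rfl
        simp at hl
      exact ⟨w.dropLast, w.getLast hw, (List.dropLast_append_getLast hw).symm⟩
    refine ⟨s, hS s (by simp), v, ⟨by simpa using hl, fun a ha => hS a (by simp [ha]), ?_, ?_⟩, rfl⟩
    · intro m c
      have h := hpos (min m v.length) c
      rw [List.take_append_of_le_length (min_le_right _ _)] at h
      rcases le_total m v.length with hm | hm
      · rwa [min_eq_left hm] at h
      · rw [min_eq_right hm, List.take_length] at h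
        rwa [List.take_of_length_le hm]
    · rw [← hsum]
      simp
  · rintro ⟨s, hs, v, ⟨hl, hS, hpos, hsum⟩, rfl⟩
    refine ⟨by simp [hl], ?_, ?_, by simp [hsum]⟩
    · intro a ha
      rcases List.mem_append.1 ha with h | h
      · exact hS a h
      · rw [List.mem_singleton.1 h]
        exact hs
    · intro m c
      rcases le_or_gt m v.length with hm | hm
      · rw [List.take_append_of_le_length hm]
        exact hpos m c
      · rw [List.take_of_length_le (by simp; omega)]
        simpa [hsum] using hp c

lemma octantWalks_finite (S : Finset (Fin 3 → ℤ)) (p : Fin 3 → ℤ) (n : ℕ) :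
    (octantWalks S p n).Finite := by
  induction n generalizing p with
  | zero =>
    rw [octantWalks_zero]
    split_ifs <;> simp
  | succ n ih =>
    by_cases hp : ∀ c, 0 ≤ p c
    · rw [octantWalks_succ n hp]
      exact S.finite_toSet.biUnion fun s _ => (ih _).image _
    · push Not at hp
      obtain ⟨c, hc⟩ := hp
      rw [octantWalks_eq_empty _ hc]
      exact Set.finite_empty

lemma walkCount_zero (S : Finset (Fin 3 → ℤ)) (p : Fin 3 → ℤ) :
    walkCount S p 0 = if p = 0 then 1 else 0 := by
  rw [walkCount_eq_ncard, octantWalks_zero]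
  split_ifs <;> simp

lemma walkCount_eq_zero_of_neg {S : Finset (Fin 3 → ℤ)} {p : Fin 3 → ℤ} (n : ℕ) {c : Fin 3}
    (hp : p c < 0) : walkCount S p n = 0 := by
  rw [walkCount_eq_ncard, octantWalks_eq_empty n hp, Set.ncard_empty]

lemma walkCount_succ {S : Finset (Fin 3 → ℤ)} {p : Fin 3 → ℤ} (n : ℕ) (hp : ∀ c, 0 ≤ p c) :
    walkCount S p (n + 1) = ∑ s ∈ S, walkCount S (p - s) n := by
  have : octantWalks S p (n + 1) = (S.biUnion fun s =>
      ((octantWalks_finite S (p - s) n).image (fun w => w ++ [s])).toFinset :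
        Finset (List (Fin 3 → ℤ))) := by
    rw [octantWalks_succ n hp]
    ext w
    simp
  rw [walkCount_eq_ncard, this, Set.ncard_coe_finset, Finset.card_biUnion]
  · refine Finset.sum_congr rfl fun s _ => ?_
    rw [← Set.ncard_eq_toFinset_card _ ((octantWalks_finite S (p - s) n).image _),
      Set.ncard_image_of_injective _ (List.append_left_injective [s]), walkCount_eq_ncard]
  · intro s _ s' _ hne
    rw [Function.onFun, Finset.disjoint_left]
    intro w hw hw'
    simp only [Set.Finite.mem_toFinset, Set.mem_image] at hw hw'
    obtain ⟨v, -, rfl⟩ := hw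
    obtain ⟨v', -, h⟩ := hw'
    exact hne (by simpa using (List.append_inj' h rfl).2.symm)

/-! ### The reflection principle -/

/-- The alternating sum over the orbit of the origin under the Weyl group of type `A₂`, which is
generated by the reflections `(j, k) ↦ (-2 - j, j + k + 1)` and `(j, k) ↦ (j + k + 1, -2 - k)`. -/
def weylSum (j k : ℤ) : ℤ :=
  (if j = 0 ∧ k = 0 then 1 else 0) - (if j = -2 ∧ k = 1 then 1 else 0)
    - (if j = 1 ∧ k = -2 then 1 else 0) + (if j = 0 ∧ k = -3 then 1 else 0)
    + (if j = -3 ∧ k = 0 then 1 else 0) - (if j = -2 ∧ k = -2 then 1 else 0)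

/-- The signed number of unrestricted `S₁`-walks with `n` steps ending at `(i, j, k)`, whose
starting points are the signed reflections of the origin in the walls of the octant. -/
def signedCount : ℕ → ℤ → ℤ → ℤ → ℤ
  | 0, i, j, k => (if i = 0 then weylSum j k else 0) -
      (if i = -2 then weylSum (j + 1) k + weylSum j (k - 1) + weylSum (j - 1) (k + 1) else 0)
  | n + 1, i, j, k =>
      signedCount n (i - 1) j k
        + (signedCount n i (j - 1) k + signedCount n i (j + 1) (k - 1) + signedCount n i j (k + 1))
        + (signedCount n (i + 1) (j + 1) k + signedCount n (i + 1) j (k - 1)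
          + signedCount n (i + 1) (j - 1) (k + 1))

lemma weylSum_reflect_left (j k : ℤ) : weylSum (-2 - j) (j + k + 1) = -weylSum j k := by
  have h0 : (-2 - j = 0 ∧ j + k + 1 = 0) ↔ (j = -2 ∧ k = 1) := by omega
  have h1 : (-2 - j = -2 ∧ j + k + 1 = 1) ↔ (j = 0 ∧ k = 0) := by omega
  have h2 : (-2 - j = 1 ∧ j + k + 1 = -2) ↔ (j = -3 ∧ k = 0) := by omega
  have h3 : (-2 - j = 0 ∧ j + k + 1 = -3) ↔ (j = -2 ∧ k = -2) := by omega
  have h4 : (-2 - j = -3 ∧ j + k + 1 = 0) ↔ (j = 1 ∧ k = -2) := by omega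
  have h5 : (-2 - j = -2 ∧ j + k + 1 = -2) ↔ (j = 0 ∧ k = -3) := by omega
  simp only [weylSum, h0, h1, h2, h3, h4, h5]
  ring

lemma weylSum_reflect_right (j k : ℤ) : weylSum (j + k + 1) (-2 - k) = -weylSum j k := by
  have h0 : (j + k + 1 = 0 ∧ -2 - k = 0) ↔ (j = 1 ∧ k = -2) := by omega
  have h1 : (j + k + 1 = -2 ∧ -2 - k = 1) ↔ (j = 0 ∧ k = -3) := by omega
  have h2 : (j + k + 1 = 1 ∧ -2 - k = -2) ↔ (j = 0 ∧ k = 0) := by omega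
  have h3 : (j + k + 1 = 0 ∧ -2 - k = -3) ↔ (j = -2 ∧ k = 1) := by omega
  have h4 : (j + k + 1 = -3 ∧ -2 - k = 0) ↔ (j = -2 ∧ k = -2) := by omega
  have h5 : (j + k + 1 = -2 ∧ -2 - k = -2) ↔ (j = -3 ∧ k = 0) := by omega
  simp only [weylSum, h0, h1, h2, h3, h4, h5]
  ring

lemma signedCount_reflect_left (n : ℕ) (i j k : ℤ) :
    signedCount n i (-2 - j) (j + k + 1) = -signedCount n i j k := by
  induction n generalizing i j k with
  | zero =>
    have h₁ := weylSum_reflect_left j k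
    have h₂ := weylSum_reflect_left (j - 1) (k + 1)
    have h₃ := weylSum_reflect_left j (k - 1)
    have h₄ := weylSum_reflect_left (j + 1) k
    simp only [signedCount]
    split_ifs <;> grind
  | succ n ih =>
    simp only [signedCount]
    grind

lemma signedCount_reflect_right (n : ℕ) (i j k : ℤ) :
    signedCount n i (j + k + 1) (-2 - k) = -signedCount n i j k := by
  induction n generalizing i j k with
  | zero =>
    have h₁ := weylSum_reflect_right j k
    have h₂ := weylSum_reflect_right (j - 1) (k + 1)
    have h₃ := weylSum_reflect_right j (k - 1)
    have h₄ := weylSum_reflect_right (j + 1) k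
    simp only [signedCount]
    split_ifs <;> grind
  | succ n ih =>
    simp only [signedCount]
    grind

/-- The action on functions of `(j, k)` of the steps of `S₁` that leave the first coordinate
unchanged. -/
def levelStep : Module.End ℤ (ℤ → ℤ → ℤ) where
  toFun φ j k := φ (j - 1) k + φ (j + 1) (k - 1) + φ j (k + 1)
  map_add' φ ψ := by
    ext j k
    simp only [Pi.add_apply]
    ring
  map_smul' c φ := by
    ext j k
    simp only [Pi.smul_apply, smul_eq_mul, RingHom.id_apply]
    ring

/-- The action on functions of `(j, k)` of the steps of `S₁` that lower the first coordinate. -/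
def downStep : Module.End ℤ (ℤ → ℤ → ℤ) where
  toFun φ j k := φ (j + 1) k + φ j (k - 1) + φ (j - 1) (k + 1)
  map_add' φ ψ := by
    ext j k
    simp only [Pi.add_apply]
    ring
  map_smul' c φ := by
    ext j k
    simp only [Pi.smul_apply, smul_eq_mul, RingHom.id_apply]
    ring

lemma commute_levelStep_downStep : Commute levelStep downStep := by
  ext φ j k
  simp only [Module.End.mul_apply, levelStep, downStep, LinearMap.coe_mk, AddHom.coe_mk]
  ring_nf

lemma signedCount_zero_eq (i : ℤ) :
    signedCount 0 i = (if i = 0 then weylSum else 0) - if i = -2 then downStep weylSum else 0 := by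
  ext j k
  simp only [signedCount, downStep, LinearMap.coe_mk, AddHom.coe_mk, Pi.sub_apply]
  split_ifs <;> simp

lemma signedCount_succ_eq (n : ℕ) (i : ℤ) :
    signedCount (n + 1) i = signedCount n (i - 1) + levelStep (signedCount n i)
      + downStep (signedCount n (i + 1)) := rfl

lemma signedCount_reflect_first (n m : ℕ) :
    signedCount n (-m - 1) = -(downStep ^ m) (signedCount n (m - 1)) := by
  induction n generalizing m with
  | zero =>
    rcases m with _ | _ | m
    · simp [signedCount_zero_eq]
    · simp [signedCount_zero_eq]
    · have h₁ : ¬ (-((m + 1 + 1 : ℕ) : ℤ) - 1 = 0) := by omega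
      have h₂ : ¬ (-((m + 1 + 1 : ℕ) : ℤ) - 1 = -2) := by omega
      have h₃ : ¬ (((m + 1 + 1 : ℕ) : ℤ) - 1 = 0) := by omega
      have h₄ : ¬ (((m + 1 + 1 : ℕ) : ℤ) - 1 = -2) := by omega
      rw [signedCount_zero_eq, signedCount_zero_eq, if_neg h₁, if_neg h₂, if_neg h₃, if_neg h₄]
      simp
  | succ n ih =>
    rcases m with _ | m
    · have h₀ := ih 0
      have h₁ := ih 1
      simp only [pow_zero, Module.End.one_apply, pow_one, Nat.cast_zero, neg_zero, zero_sub,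
        Nat.cast_one, sub_self] at h₀ h₁
      have h₂ : signedCount n (-1) = 0 := self_eq_neg.1 h₀
      have h₃ : signedCount (n + 1) (-1) = 0 := by
        rw [signedCount_succ_eq, h₁, h₂]
        simp
      simp [h₃]
    · have h₀ := ih m
      have h₁ := ih (m + 1)
      have h₂ := ih (m + 2)
      push_cast at h₀ h₁ h₂ ⊢
      have e₁ : -((m : ℤ) + 1) - 1 - 1 = -((m : ℤ) + 2) - 1 := by ring
      have e₂ : -((m : ℤ) + 1) - 1 + 1 = -(m : ℤ) - 1 := by ring
      have e₃ : (m : ℤ) + 1 - 1 + 1 = (m : ℤ) + 2 - 1 := by ring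
      have e₄ : (m : ℤ) + 1 - 1 - 1 = (m : ℤ) - 1 := by ring
      rw [signedCount_succ_eq, signedCount_succ_eq, e₁, e₂, e₃, e₄, h₀, h₁, h₂]
      have hc : levelStep ((downStep ^ (m + 1)) (signedCount n (m + 1 - 1))) =
          (downStep ^ (m + 1)) (levelStep (signedCount n (m + 1 - 1))) :=
        LinearMap.congr_fun (commute_levelStep_downStep.pow_right (m + 1)) _
      have hd : downStep ((downStep ^ m) (signedCount n (m - 1))) =
          (downStep ^ (m + 1)) (signedCount n (m - 1)) := by
        rw [pow_succ', Module.End.mul_apply]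
      have he : (downStep ^ (m + 2)) (signedCount n (m + 2 - 1)) =
          (downStep ^ (m + 1)) (downStep (signedCount n (m + 2 - 1))) := by
        rw [pow_succ, Module.End.mul_apply]
      rw [map_neg, map_neg, hc, hd, he, map_add, map_add]
      abel

lemma signedCount_wall (n : ℕ) {i j k : ℤ} (h : i = -1 ∨ j = -1 ∨ k = -1) :
    signedCount n i j k = 0 := by
  rcases h with rfl | rfl | rfl
  · have h := congr_fun (congr_fun (signedCount_reflect_first n 0) j) k
    simp only [Nat.cast_zero, neg_zero, zero_sub, pow_zero, Module.End.one_apply,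
      Pi.neg_apply] at h
    omega
  · have h := signedCount_reflect_left n i (-1) k
    norm_num at h
    omega
  · have h := signedCount_reflect_right n i j (-1)
    norm_num at h
    omega

lemma weylSum_eq_zero {j k : ℤ} (h : 3 < |j| ∨ 3 < |k|) : weylSum j k = 0 := by
  simp only [lt_abs] at h
  have h₀ : ¬ (j = 0 ∧ k = 0) := by omega
  have h₁ : ¬ (j = -2 ∧ k = 1) := by omega
  have h₂ : ¬ (j = 1 ∧ k = -2) := by omega
  have h₃ : ¬ (j = 0 ∧ k = -3) := by omega
  have h₄ : ¬ (j = -3 ∧ k = 0) := by omega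
  have h₅ : ¬ (j = -2 ∧ k = -2) := by omega
  simp [weylSum, h₀, h₁, h₂, h₃, h₄, h₅]

lemma signedCount_zero_of_abs {i j k : ℤ} (h : 4 < |i| ∨ 4 < |j| ∨ 4 < |k|) :
    signedCount 0 i j k = 0 := by
  simp only [lt_abs] at h
  simp only [signedCount]
  by_cases hi : 4 < i ∨ 4 < -i
  · rw [if_neg (by omega), if_neg (by omega), sub_zero]
  · rw [weylSum_eq_zero (by simp only [lt_abs]; omega),
      weylSum_eq_zero (by simp only [lt_abs]; omega),
      weylSum_eq_zero (by simp only [lt_abs]; omega),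
      weylSum_eq_zero (by simp only [lt_abs]; omega)]
    simp

lemma signedCount_eq_zero_of_lt (n : ℕ) {i j k : ℤ} (h : n + 4 < i ∨ n + 4 < j ∨ n + 4 < k) :
    signedCount n i j k = 0 := by
  induction n generalizing i j k with
  | zero =>
    refine signedCount_zero_of_abs ?_
    have := le_abs_self i
    have := le_abs_self j
    have := le_abs_self k
    push_cast at h
    omega
  | succ n ih =>
    simp only [signedCount]
    push_cast at h
    rw [ih (by omega), ih (by omega), ih (by omega), ih (by omega), ih (by omega), ih (by omega),
      ih (by omega)]
    rfl

lemma signedCount_zero_of_nonneg {i j k : ℤ} (hi : 0 ≤ i) (hj : 0 ≤ j) (hk : 0 ≤ k) :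
    signedCount 0 i j k = if i = 0 ∧ j = 0 ∧ k = 0 then 1 else 0 := by
  simp only [signedCount, weylSum]
  grind

lemma sum_S₁ {M : Type*} [AddCommMonoid M] (f : (Fin 3 → ℤ) → M) :
    ∑ s ∈ S₁, f s = f ![-1,-1,0] + (f ![-1,0,1] + (f ![-1,1,-1] + (f ![0,-1,1] +
      (f ![0,0,-1] + (f ![0,1,0] + f ![1,0,0]))))) := by
  unfold S₁
  rw [Finset.sum_insert (by decide), Finset.sum_insert (by decide), Finset.sum_insert (by decide),
    Finset.sum_insert (by decide), Finset.sum_insert (by decide), Finset.sum_insert (by decide),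
    Finset.sum_singleton]

lemma signedCount_succ_eq_sum (n : ℕ) (p : Fin 3 → ℤ) :
    signedCount (n + 1) (p 0) (p 1) (p 2) =
      ∑ s ∈ S₁, signedCount n ((p - s) 0) ((p - s) 1) ((p - s) 2) := by
  rw [sum_S₁]
  simp only [signedCount, Pi.sub_apply, Matrix.cons_val, sub_neg_eq_add, sub_zero]
  ring

/-- The octant walks are counted by the signed sum of unrestricted walks. -/
theorem walkCount_S₁_eq (n : ℕ) {p : Fin 3 → ℤ} (hp : ∀ c, 0 ≤ p c) :
    (walkCount S₁ p n : ℤ) = signedCount n (p 0) (p 1) (p 2) := by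
  induction n generalizing p with
  | zero =>
    rw [walkCount_zero, signedCount_zero_of_nonneg (hp 0) (hp 1) (hp 2)]
    have : p = 0 ↔ p 0 = 0 ∧ p 1 = 0 ∧ p 2 = 0 := by
      simp [funext_iff, Fin.forall_fin_succ]
    simp [this]
  | succ n ih =>
    rw [walkCount_succ n hp, signedCount_succ_eq_sum]
    push_cast
    refine Finset.sum_congr rfl fun s hs => ?_
    by_cases h : ∀ c, 0 ≤ (p - s) c
    · exact ih h
    · have hle : ∀ s ∈ S₁, ∀ c, s c ≤ 1 := by decide
      push Not at h
      obtain ⟨c, hc⟩ := h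
      rw [walkCount_eq_zero_of_neg n hc, signedCount_wall, Nat.cast_zero]
      have h₁ : (p - s) c = -1 := by
        have := hle s hs c
        have := hp c
        rw [Pi.sub_apply] at hc ⊢
        omega
      fin_cases c <;> simp_all

lemma walkCount_S₁_eq_zero_of_lt {n : ℕ} {p : Fin 3 → ℤ} {c : Fin 3} (h : n < p c) :
    walkCount S₁ p n = 0 := by
  induction n generalizing p with
  | zero =>
    rw [walkCount_zero, if_neg]
    rintro rfl
    simp at h
  | succ n ih =>
    by_cases hp : ∀ c, 0 ≤ p c
    · have hle : ∀ s ∈ S₁, ∀ c, s c ≤ 1 := by decide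
      rw [walkCount_succ n hp]
      refine Finset.sum_eq_zero fun s hs => ih ?_
      have := hle s hs c
      rw [Pi.sub_apply]
      push_cast at h
      omega
    · push Not at hp
      obtain ⟨c, hc⟩ := hp
      exact walkCount_eq_zero_of_neg _ hc

/-! ### Formal Laurent series in three variables over power series -/

section LaurentOperators

variable {R : Type*} [CommRing R]

/-- Families of power series in `t`, indexed by the exponents of three further variables. -/
abbrev LaurentFamily (R : Type*) [CommRing R] := (Fin 3 → ℤ) → PowerSeries R

/-- Multiplication by the monomial with exponent `v`. -/
def mulMonomial (v : Fin 3 → ℤ) : Module.End R (LaurentFamily R) :=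
  LinearMap.funLeft R (PowerSeries R) fun p => p - v

/-- Multiplication by `t`. -/
def mulTime : Module.End R (LaurentFamily R) where
  toFun ψ p := PowerSeries.X * ψ p
  map_add' φ ψ := by
    ext1 p
    exact mul_add _ _ _
  map_smul' c ψ := by
    ext1 p
    exact mul_smul_comm c PowerSeries.X (ψ p)

/-- The derivative with respect to `t`. -/
def timeDeriv : Module.End R (LaurentFamily R) where
  toFun ψ p := PowerSeries.derivative R (ψ p)
  map_add' φ ψ := by
    ext1 p
    exact map_add (PowerSeries.derivative R) (φ p) (ψ p)
  map_smul' c ψ := by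
    ext1 p
    exact (PowerSeries.derivative R).map_smul c (ψ p)

/-- The derivative with respect to one of the three Laurent variables. -/
def coordDeriv (d : Fin 3) : Module.End R (LaurentFamily R) where
  toFun ψ p := ((p d + 1 : ℤ) : R) • ψ (p + Pi.single d 1)
  map_add' φ ψ := by
    ext1 p
    exact smul_add _ _ _
  map_smul' c ψ := by
    ext1 p
    exact smul_comm _ c (ψ (p + Pi.single d 1))

/-- The four partial derivatives. -/
def partialDeriv : Option (Fin 3) → Module.End R (LaurentFamily R)
  | none => timeDeriv
  | some d => coordDeriv d

@[simp] lemma mulMonomial_apply (v : Fin 3 → ℤ) (ψ : LaurentFamily R) (p : Fin 3 → ℤ) :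
    mulMonomial v ψ p = ψ (p - v) := rfl

@[simp] lemma mulTime_apply (ψ : LaurentFamily R) (p : Fin 3 → ℤ) :
    mulTime ψ p = PowerSeries.X * ψ p := rfl

@[simp] lemma timeDeriv_apply (ψ : LaurentFamily R) (p : Fin 3 → ℤ) :
    timeDeriv ψ p = PowerSeries.derivative R (ψ p) := rfl

@[simp] lemma coordDeriv_apply (d : Fin 3) (ψ : LaurentFamily R) (p : Fin 3 → ℤ) :
    coordDeriv d ψ p = ((p d + 1 : ℤ) : R) • ψ (p + Pi.single d 1) := rfl

variable (R) in
/-- The algebra of multiplications by Laurent polynomials with coefficients in `R[t]`. -/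
def laurentOps : Subalgebra R (Module.End R (LaurentFamily R)) :=
  Algebra.adjoin R (Set.range mulMonomial ∪ {mulTime})

lemma mulMonomial_mem_laurentOps (v : Fin 3 → ℤ) : mulMonomial v ∈ laurentOps R :=
  Algebra.subset_adjoin (Or.inl ⟨v, rfl⟩)

lemma mulTime_mem_laurentOps : mulTime ∈ laurentOps R :=
  Algebra.subset_adjoin (Or.inr rfl)

@[elab_as_elim]
lemma laurentOps_induction
    {motive : (L : Module.End R (LaurentFamily R)) → L ∈ laurentOps R → Prop}
    (mulMonomial : ∀ v, motive (mulMonomial v) (mulMonomial_mem_laurentOps v))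
    (mulTime : motive mulTime mulTime_mem_laurentOps)
    (scalar : ∀ r : R, motive (algebraMap R _ r) (algebraMap_mem _ r))
    (add : ∀ a b ha hb, motive a ha → motive b hb → motive (a + b) (add_mem ha hb))
    (mul : ∀ a b ha hb, motive a ha → motive b hb → motive (a * b) (mul_mem ha hb))
    {L : Module.End R (LaurentFamily R)} (hL : L ∈ laurentOps R) : motive L hL := by
  refine Algebra.adjoin_induction (p := motive) ?_ scalar add mul hL
  rintro _ (⟨v, rfl⟩ | rfl)
  · exact mulMonomial v
  · exact mulTime

lemma laurentOps_commute {L L' : Module.End R (LaurentFamily R)} (hL : L ∈ laurentOps R)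
    (hL' : L' ∈ laurentOps R) : Commute L L' := by
  refine Algebra.commute_of_mem_adjoin_of_forall_mem_commute (R := R)
    (s := Set.range mulMonomial ∪ {mulTime}) hL' ?_
  intro b hb
  refine (Algebra.commute_of_mem_adjoin_of_forall_mem_commute (R := R)
    (s := Set.range mulMonomial ∪ {mulTime}) hL ?_).symm
  intro a ha
  rcases ha with ⟨v, rfl⟩ | rfl <;> rcases hb with ⟨w, rfl⟩ | rfl
  · refine LinearMap.ext fun ψ => funext fun p => ?_
    simp [sub_right_comm]
  · rfl
  · rfl
  · rfl

/-- Multiplications by Laurent polynomials are linear over all power series in `t`. -/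
lemma laurentOps_map_smul {L : Module.End R (LaurentFamily R)} (hL : L ∈ laurentOps R)
    (a : PowerSeries R) (ψ : LaurentFamily R) : L (a • ψ) = a • L ψ := by
  induction hL using laurentOps_induction generalizing ψ with
  | mulMonomial v => rfl
  | mulTime =>
    ext1 p
    exact mul_smul_comm a PowerSeries.X (ψ p)
  | scalar r =>
    rw [Module.algebraMap_end_apply, Module.algebraMap_end_apply, smul_comm]
  | add L L' _ _ h h' => simp [h, h']
  | mul L L' _ _ h h' => simp [h, h']

lemma commutator_mem_laurentOps (D : Option (Fin 3)) {L : Module.End R (LaurentFamily R)}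
    (hL : L ∈ laurentOps R) :
    partialDeriv D * L - L * partialDeriv D ∈ laurentOps R := by
  induction hL using laurentOps_induction with
  | mulMonomial v =>
    rcases D with _ | d
    · have : (partialDeriv none * mulMonomial v - mulMonomial v * partialDeriv none :
          Module.End R (LaurentFamily R)) = 0 := sub_eq_zero.2 rfl
      rw [this]
      exact zero_mem _
    · have : (partialDeriv (some d) * mulMonomial v - mulMonomial v * partialDeriv (some d) :
          Module.End R (LaurentFamily R)) = ((v d : ℤ) : R) • mulMonomial (v - Pi.single d 1) := by
        refine LinearMap.ext fun ψ => funext fun p => ?_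
        have h₁ : p - v + Pi.single d 1 = p + Pi.single d 1 - v := by abel
        have h₂ : p - (v - Pi.single d 1) = p + Pi.single d 1 - v := by abel
        simp only [partialDeriv, LinearMap.sub_apply, Module.End.mul_apply, Pi.sub_apply,
          coordDeriv_apply, mulMonomial_apply, LinearMap.smul_apply, Pi.smul_apply, h₁, h₂,
          ← sub_smul]
        congr 1
        push_cast
        ring
      rw [this]
      exact Subalgebra.smul_mem _ (mulMonomial_mem_laurentOps _) _
  | mulTime =>
    rcases D with _ | d
    · have : (partialDeriv none * mulTime - mulTime * partialDeriv none :
          Module.End R (LaurentFamily R)) = 1 := by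
        refine LinearMap.ext fun ψ => funext fun p => ?_
        simp [partialDeriv, PowerSeries.derivative_X]
      rw [this]
      exact one_mem _
    · have : (partialDeriv (some d) * mulTime - mulTime * partialDeriv (some d) :
          Module.End R (LaurentFamily R)) = 0 := by
        refine LinearMap.ext fun ψ => funext fun p => ?_
        simp [partialDeriv]
      rw [this]
      exact zero_mem _
  | scalar r =>
    rw [Algebra.commutes, sub_self]
    exact zero_mem _
  | add a b _ _ ha hb =>
    have : partialDeriv D * (a + b) - (a + b) * partialDeriv D =
        (partialDeriv D * a - a * partialDeriv D) + (partialDeriv D * b - b * partialDeriv D) := by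
      noncomm_ring
    rw [this]
    exact add_mem ha hb
  | mul a b ha' hb' ha hb =>
    have : partialDeriv D * (a * b) - (a * b) * partialDeriv D =
        (partialDeriv D * a - a * partialDeriv D) * b +
          a * (partialDeriv D * b - b * partialDeriv D) := by
      simp only [sub_mul, mul_sub, mul_assoc]
      abel
    rw [this]
    exact add_mem (mul_mem ha hb') (mul_mem ha' hb)

/-! ### Laurent polynomials -/

/-- The families that are Laurent polynomials with coefficients in `R[t]` and with all exponents
bounded by `N` in absolute value. -/
def IsLaurentPoly (N : ℕ) (ψ : LaurentFamily R) : Prop :=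
  (∀ p d, (N : ℤ) < |p d| → ψ p = 0) ∧ ∀ p, ∃ q : Polynomial R, (q : PowerSeries R) = ψ p

lemma IsLaurentPoly.mono {N N' : ℕ} {ψ : LaurentFamily R} (h : IsLaurentPoly N ψ) (hN : N ≤ N') :
    IsLaurentPoly N' ψ :=
  ⟨fun p d hp => h.1 p d (by omega), h.2⟩

lemma IsLaurentPoly.add {N : ℕ} {φ ψ : LaurentFamily R} (hφ : IsLaurentPoly N φ)
    (hψ : IsLaurentPoly N ψ) : IsLaurentPoly N (φ + ψ) := by
  refine ⟨fun p d hp => by simp [hφ.1 p d hp, hψ.1 p d hp], fun p => ?_⟩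
  obtain ⟨a, ha⟩ := hφ.2 p
  obtain ⟨b, hb⟩ := hψ.2 p
  exact ⟨a + b, by simp [ha, hb]⟩

lemma IsLaurentPoly.smul {N : ℕ} {ψ : LaurentFamily R} (hψ : IsLaurentPoly N ψ) (r : R) :
    IsLaurentPoly N (r • ψ) := by
  refine ⟨fun p d hp => by simp [hψ.1 p d hp], fun p => ?_⟩
  obtain ⟨a, ha⟩ := hψ.2 p
  exact ⟨r • a, by simp [← ha, Polynomial.smul_eq_C_mul, PowerSeries.smul_eq_C_mul]⟩

lemma exists_isLaurentPoly_of_mem_laurentOps {L : Module.End R (LaurentFamily R)}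
    (hL : L ∈ laurentOps R) :
    ∃ δ : ℕ, ∀ N ψ, IsLaurentPoly N ψ → IsLaurentPoly (N + δ) (L ψ) := by
  induction hL using laurentOps_induction with
  | mulMonomial v =>
    refine ⟨∑ d, (v d).natAbs, fun N ψ h => ⟨fun p d hp => h.1 _ d ?_, fun p => h.2 _⟩⟩
    have h₁ : (v d).natAbs ≤ ∑ d, (v d).natAbs :=
      Finset.single_le_sum (f := fun d => (v d).natAbs) (fun _ _ => Nat.zero_le _)
        (Finset.mem_univ d)
    have h₂ := abs_sub_abs_le_abs_sub (p d) (v d)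
    change (N : ℤ) < |p d - v d|
    zify at h₁
    push_cast at hp
    omega
  | mulTime =>
    refine ⟨0, fun N ψ h => ⟨fun p d hp => by simp [h.1 p d hp], fun p => ?_⟩⟩
    obtain ⟨q, hq⟩ := h.2 p
    exact ⟨Polynomial.X * q, by simp [hq]⟩
  | scalar r => exact ⟨0, fun N ψ h => h.smul r⟩
  | add a b _ _ ha hb =>
    obtain ⟨δ, ha⟩ := ha
    obtain ⟨ε, hb⟩ := hb
    exact ⟨δ + ε, fun N ψ h => ((ha N ψ h).mono (by omega)).add ((hb N ψ h).mono (by omega))⟩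
  | mul a b _ _ ha hb =>
    obtain ⟨δ, ha⟩ := ha
    obtain ⟨ε, hb⟩ := hb
    exact ⟨ε + δ, fun N ψ h => by simpa [add_assoc] using ha _ _ (hb N ψ h)⟩

lemma IsLaurentPoly.partialDeriv {N : ℕ} {ψ : LaurentFamily R} (h : IsLaurentPoly N ψ)
    (D : Option (Fin 3)) : IsLaurentPoly (N + 1) (partialDeriv D ψ) := by
  rcases D with _ | d
  · refine ⟨fun p d hp => by simp [_root_.partialDeriv, h.1 p d (by push_cast at hp; omega)],
      fun p => ?_⟩
    obtain ⟨q, hq⟩ := h.2 p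
    exact ⟨Polynomial.derivative q, by simp [_root_.partialDeriv, ← hq, PowerSeries.derivative_coe]⟩
  · refine ⟨fun p e hp => ?_, fun p => ?_⟩
    · have : (N : ℤ) < |(p + Pi.single d 1 : Fin 3 → ℤ) e| := by
        rw [Pi.add_apply, Pi.single_apply]
        push_cast at hp
        split_ifs <;> grind
      simp [_root_.partialDeriv, h.1 _ e this]
    · obtain ⟨q, hq⟩ := h.2 (p + Pi.single d 1)
      refine ⟨((p d + 1 : ℤ) : R) • q, ?_⟩
      rw [Polynomial.smul_eq_C_mul, Polynomial.coe_mul, Polynomial.coe_C, hq,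
        ← PowerSeries.smul_eq_C_mul]
      rfl

lemma partialDeriv_mul_pow (D : Option (Fin 3)) {Q : Module.End R (LaurentFamily R)}
    (hQ : Q ∈ laurentOps R) (m : ℕ) :
    partialDeriv D * Q ^ (m + 1) = Q ^ (m + 1) * partialDeriv D +
      (m + 1) • ((partialDeriv D * Q - Q * partialDeriv D) * Q ^ m) := by
  set C := partialDeriv D * Q - Q * partialDeriv D with hC
  have hDQ : partialDeriv D * Q = Q * partialDeriv D + C := by
    rw [hC]
    abel
  have hcomm : Commute C Q := laurentOps_commute (commutator_mem_laurentOps D hQ) hQ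
  induction m with
  | zero => simp [hDQ]
  | succ m ih =>
    have h : Q ^ (m + 1) * C = C * Q ^ (m + 1) := (hcomm.pow_right (m + 1)).eq.symm
    rw [pow_succ Q (m + 1), ← mul_assoc, ih, add_mul, mul_assoc, hDQ, mul_add, smul_mul_assoc,
      mul_assoc C, ← pow_succ, h, add_assoc, ← succ_nsmul', mul_assoc]

/-- Differentiating a fraction whose denominator is a power of `Q` raises the exponent of the
denominator by one and the degree of the numerator by a bounded amount. -/
lemma exists_isLaurentPoly_partialDeriv {Q : Module.End R (LaurentFamily R)}
    (hQ : Q ∈ laurentOps R) :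
    ∃ δ : ℕ, (∀ N ψ, IsLaurentPoly N ψ → IsLaurentPoly (N + δ) (Q ψ)) ∧
      ∀ D m N φ, IsLaurentPoly N ((Q ^ (m + 1)) φ) →
        IsLaurentPoly (N + δ) ((Q ^ (m + 2)) (partialDeriv D φ)) := by
  obtain ⟨ε, hε⟩ := exists_isLaurentPoly_of_mem_laurentOps hQ
  choose η hη using fun D =>
    exists_isLaurentPoly_of_mem_laurentOps (commutator_mem_laurentOps D hQ)
  have hsum : ∀ D, η D ≤ ∑ D, η D := fun D =>
    Finset.single_le_sum (fun _ _ => Nat.zero_le _) (Finset.mem_univ D)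
  refine ⟨1 + ε + ∑ D, η D, fun N ψ h => (hε N ψ h).mono (by omega), fun D m N φ h => ?_⟩
  have hcomm : Q * (partialDeriv D * Q - Q * partialDeriv D) =
      (partialDeriv D * Q - Q * partialDeriv D) * Q :=
    (laurentOps_commute (commutator_mem_laurentOps D hQ) hQ).eq.symm
  have key : Q ^ (m + 2) * partialDeriv D = Q * (partialDeriv D * Q ^ (m + 1)) +
      (-(m + 1 : R)) • ((partialDeriv D * Q - Q * partialDeriv D) * Q ^ (m + 1)) := by
    have h₁ : (-(m + 1 : R)) • ((partialDeriv D * Q - Q * partialDeriv D) * Q ^ (m + 1)) =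
        -((m + 1) • ((partialDeriv D * Q - Q * partialDeriv D) * Q ^ (m + 1))) := by
      refine LinearMap.ext fun ψ => ?_
      rw [LinearMap.smul_apply, LinearMap.neg_apply, LinearMap.smul_apply, neg_smul,
        ← Nat.cast_smul_eq_nsmul R]
      push_cast
      rfl
    rw [h₁, partialDeriv_mul_pow D hQ, mul_add, mul_smul_comm, ← mul_assoc Q, ← mul_assoc Q,
      ← pow_succ', hcomm, mul_assoc _ Q, ← pow_succ']
    abel
  have := LinearMap.congr_fun key φ
  rw [Module.End.mul_apply] at this
  rw [this]
  refine IsLaurentPoly.add ?_ (IsLaurentPoly.smul ?_ _)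
  · exact (hε _ _ (h.partialDeriv D)).mono (by omega)
  · exact (hη D _ _ h).mono (by have := hsum D; omega)

/-! ### Iterated derivatives -/

/-- The differential operator `∂_t ^ a ∂_x ^ β₀ ∂_y ^ β₁ ∂_z ^ β₂`. -/
def multiDeriv (a : ℕ) (β : Fin 3 → ℕ) : Module.End R (LaurentFamily R) :=
  partialDeriv none ^ a * (partialDeriv (some 0) ^ β 0 *
    (partialDeriv (some 1) ^ β 1 * partialDeriv (some 2) ^ β 2))

lemma timeDeriv_pow_apply (a : ℕ) (ψ : LaurentFamily R) (p : Fin 3 → ℤ) :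
    (timeDeriv ^ a) ψ p = (PowerSeries.derivative R)^[a] (ψ p) := by
  induction a with
  | zero => rfl
  | succ a ih => rw [pow_succ', Module.End.mul_apply, timeDeriv_apply, ih,
      Function.iterate_succ_apply']

lemma coordDeriv_pow_apply (d : Fin 3) (b : ℕ) (ψ : LaurentFamily R) (p : Fin 3 → ℤ) :
    (coordDeriv d ^ b) ψ p =
      ((∏ l ∈ Finset.range b, (p d + 1 + l) : ℤ) : R) • ψ (p + Pi.single d (b : ℤ)) := by
  induction b generalizing p with
  | zero => simp
  | succ b ih =>
    have h₁ : p + Pi.single d 1 + Pi.single d (b : ℤ) = p + Pi.single d ((b + 1 : ℕ) : ℤ) := by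
      rw [add_assoc, ← Pi.single_add]
      push_cast
      rw [add_comm (1 : ℤ)]
    rw [pow_succ', Module.End.mul_apply, coordDeriv_apply, ih, h₁, smul_smul, ← Int.cast_mul]
    congr 2
    rw [Finset.prod_range_succ', mul_comm]
    simp only [Pi.add_apply, Pi.single_eq_same]
    push_cast
    congr 1
    · exact Finset.prod_congr rfl fun l _ => by ring
    · ring

lemma derivative_iterate_smul (a : ℕ) (r : R) (f : PowerSeries R) :
    (PowerSeries.derivative R)^[a] (r • f) = r • (PowerSeries.derivative R)^[a] f := by
  induction a with
  | zero => rfl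
  | succ a ih => rw [Function.iterate_succ_apply', Function.iterate_succ_apply', ih,
      Derivation.map_smul]

lemma multiDeriv_apply (a : ℕ) (β : Fin 3 → ℕ) (ψ : LaurentFamily R) (p : Fin 3 → ℤ) :
    multiDeriv a β ψ p = ((∏ d, ∏ l ∈ Finset.range (β d), (p d + 1 + l) : ℤ) : R) •
      (PowerSeries.derivative R)^[a] (ψ (p + fun d => (β d : ℤ))) := by
  simp only [multiDeriv, partialDeriv, Module.End.mul_apply]
  rw [timeDeriv_pow_apply, coordDeriv_pow_apply, coordDeriv_pow_apply, coordDeriv_pow_apply,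
    smul_smul, smul_smul, derivative_iterate_smul, ← Int.cast_mul, ← Int.cast_mul,
    Fin.prod_univ_three]
  congr 2
  · simp
  · congr 1
    ext d
    fin_cases d <;> simp

lemma prod_shift_eq_zero {β γ : Fin 3 → ℕ} (h : ¬ β ≤ γ) :
    (∏ d, ∏ l ∈ Finset.range (β d), (-(γ d : ℤ) - 1 + 1 + l)) = 0 := by
  rw [Pi.le_def] at h
  push Not at h
  obtain ⟨d, hd⟩ := h
  exact Finset.prod_eq_zero (Finset.mem_univ d)
    (Finset.prod_eq_zero (Finset.mem_range.2 hd) (by ring))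

lemma prod_shift_ne_zero (γ : Fin 3 → ℕ) :
    (∏ d, ∏ l ∈ Finset.range (γ d), (-(γ d : ℤ) - 1 + 1 + l)) ≠ 0 := by
  refine Finset.prod_ne_zero_iff.2 fun d _ => Finset.prod_ne_zero_iff.2 fun l hl => ?_
  have := Finset.mem_range.1 hl
  omega

lemma isLaurentPoly_multiDeriv {Q : Module.End R (LaurentFamily R)} (hQ : Q ∈ laurentOps R)
    {N : ℕ} {H : LaurentFamily R} (hH : IsLaurentPoly N (Q H)) :
    ∃ δ : ℕ, ∀ K a β, a ≤ K → (∀ d, β d ≤ K) →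
      IsLaurentPoly (N + δ * (4 * K)) ((Q ^ (4 * K + 1)) (multiDeriv a β H)) := by
  obtain ⟨δ, h₁, h₂⟩ := exists_isLaurentPoly_partialDeriv hQ
  have hmono : ∀ m j φ, IsLaurentPoly (N + δ * m) ((Q ^ (m + 1)) φ) →
      IsLaurentPoly (N + δ * (m + j)) ((Q ^ (m + j + 1)) φ) := by
    intro m j φ h
    induction j with
    | zero => exact h
    | succ j ih =>
      rw [pow_succ' Q (m + (j + 1)), Module.End.mul_apply]
      exact (h₁ _ _ ih).mono (le_of_eq (by ring))
  have hpow : ∀ D j m φ, IsLaurentPoly (N + δ * m) ((Q ^ (m + 1)) φ) →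
      IsLaurentPoly (N + δ * (m + j)) ((Q ^ (m + j + 1)) ((partialDeriv D ^ j) φ)) := by
    intro D j m φ h
    induction j with
    | zero => exact h
    | succ j ih =>
      rw [pow_succ' (partialDeriv D), Module.End.mul_apply]
      exact (h₂ D _ _ _ ih).mono (le_of_eq (by ring))
  refine ⟨δ, fun K a β ha hβ => ?_⟩
  have h₀ : IsLaurentPoly (N + δ * 0) ((Q ^ (0 + 1)) H) := by simpa using hH
  have h := hpow none a _ _ (hpow (some 0) (β 0) _ _ (hpow (some 1) (β 1) _ _
    (hpow (some 2) (β 2) _ _ h₀)))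
  have hK : 0 + β 2 + β 1 + β 0 + a + (4 * K - (0 + β 2 + β 1 + β 0 + a)) = 4 * K := by
    have := hβ 0
    have := hβ 1
    have := hβ 2
    omega
  have := hmono _ (4 * K - (0 + β 2 + β 1 + β 0 + a)) _ h
  rw [hK] at this
  exact this

/-! ### Families with bounded support -/

/-- The exponents occurring in the coefficient of `t ^ n` are at most `n + b`. -/
def IsBoundedAbove (b : ℕ) (ψ : LaurentFamily R) : Prop :=
  ∀ (n : ℕ) (p : Fin 3 → ℤ) (d : Fin 3), (n + b : ℤ) < p d → PowerSeries.coeff n (ψ p) = 0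

lemma IsBoundedAbove.mono {b b' : ℕ} {ψ : LaurentFamily R} (h : IsBoundedAbove b ψ)
    (hb : b ≤ b') : IsBoundedAbove b' ψ :=
  fun n p d hp => h n p d (by omega)

lemma IsBoundedAbove.add {b : ℕ} {φ ψ : LaurentFamily R} (hφ : IsBoundedAbove b φ)
    (hψ : IsBoundedAbove b ψ) : IsBoundedAbove b (φ + ψ) :=
  fun n p d hp => by rw [Pi.add_apply, map_add, hφ n p d hp, hψ n p d hp, add_zero]

lemma IsBoundedAbove.smul {b : ℕ} {ψ : LaurentFamily R} (h : IsBoundedAbove b ψ)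
    (a : PowerSeries R) : IsBoundedAbove b (a • ψ) := by
  intro n p d hp
  rw [Pi.smul_apply, smul_eq_mul, PowerSeries.coeff_mul]
  refine Finset.sum_eq_zero fun x hx => ?_
  have := Finset.HasAntidiagonal.mem_antidiagonal.1 hx
  rw [h x.2 p d (by omega), mul_zero]

lemma IsBoundedAbove.sum {ι : Type*} {b : ℕ} (s : Finset ι) {ψ : ι → LaurentFamily R}
    (h : ∀ i ∈ s, IsBoundedAbove b (ψ i)) : IsBoundedAbove b (∑ i ∈ s, ψ i) := by
  intro n p d hp
  rw [Finset.sum_apply, map_sum]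
  exact Finset.sum_eq_zero fun i hi => h i hi n p d hp

lemma IsBoundedAbove.partialDeriv {b : ℕ} {ψ : LaurentFamily R} (h : IsBoundedAbove b ψ)
    (D : Option (Fin 3)) : IsBoundedAbove (b + 1) (partialDeriv D ψ) := by
  intro n p e hp
  rcases D with _ | d
  · simp only [_root_.partialDeriv, timeDeriv_apply, PowerSeries.coeff_derivative]
    rw [h (n + 1) p e (by push_cast at hp ⊢; omega), zero_mul]
  · have : (n + b : ℤ) < (p + Pi.single d 1 : Fin 3 → ℤ) e := by
      rw [Pi.add_apply, Pi.single_apply]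
      push_cast at hp
      split_ifs <;> omega
    simp only [_root_.partialDeriv, coordDeriv_apply]
    rw [map_smul, h n _ e this, smul_zero]

lemma exists_isBoundedAbove_of_mem_laurentOps {L : Module.End R (LaurentFamily R)}
    (hL : L ∈ laurentOps R) {b : ℕ} {ψ : LaurentFamily R} (h : IsBoundedAbove b ψ) :
    ∃ b', IsBoundedAbove b' (L ψ) := by
  induction hL using laurentOps_induction generalizing b ψ with
  | mulMonomial v =>
    refine ⟨b + ∑ d, (v d).natAbs, fun n p d hp => h n _ d ?_⟩
    have h₁ : (v d).natAbs ≤ ∑ d, (v d).natAbs :=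
      Finset.single_le_sum (f := fun d => (v d).natAbs) (fun _ _ => Nat.zero_le _)
        (Finset.mem_univ d)
    change (n + b : ℤ) < p d - v d
    zify at h₁
    push_cast at hp
    have := le_abs_self (v d)
    omega
  | mulTime => exact ⟨b, h.smul PowerSeries.X⟩
  | scalar r =>
    refine ⟨b, fun n p d hp => ?_⟩
    rw [Module.algebraMap_end_apply, Pi.smul_apply, map_smul, h n p d hp, smul_zero]
  | add L L' _ _ hL hL' =>
    obtain ⟨b₁, h₁⟩ := hL h
    obtain ⟨b₂, h₂⟩ := hL' h
    exact ⟨b₁ + b₂, (h₁.mono (by omega)).add (h₂.mono (by omega))⟩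
  | mul L L' _ _ hL hL' =>
    obtain ⟨b₁, h₁⟩ := hL' h
    exact hL h₁

lemma isBoundedAbove_multiDeriv {b : ℕ} {ψ : LaurentFamily R} (h : IsBoundedAbove b ψ)
    (a : ℕ) (β : Fin 3 → ℕ) :
    IsBoundedAbove (b + β 2 + β 1 + β 0 + a) (multiDeriv a β ψ) := by
  have hpow : ∀ D j c φ, IsBoundedAbove c φ →
      IsBoundedAbove (c + j) ((partialDeriv D ^ j : Module.End R (LaurentFamily R)) φ) := by
    intro D j c φ hφ
    induction j with
    | zero => exact hφ
    | succ j ih =>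
      rw [pow_succ', Module.End.mul_apply]
      exact ih.partialDeriv D
  exact hpow none a _ _ (hpow (some 0) (β 0) _ _ (hpow (some 1) (β 1) _ _
    (hpow (some 2) (β 2) _ _ h)))

lemma pow_apply_eq_zero {Q : Module.End R (LaurentFamily R)} (hQ : Q ∈ laurentOps R)
    (hinj : ∀ b ψ, IsBoundedAbove b ψ → Q ψ = 0 → ψ = 0) (m : ℕ) {b : ℕ} {ψ : LaurentFamily R}
    (hψ : IsBoundedAbove b ψ) (h : (Q ^ m) ψ = 0) : ψ = 0 := by
  induction m with
  | zero => exact h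
  | succ m ih =>
    obtain ⟨b', hb'⟩ := exists_isBoundedAbove_of_mem_laurentOps (pow_mem hQ m) hψ
    rw [pow_succ', Module.End.mul_apply] at h
    exact ih (hinj b' _ hb' h)

/-! ### Elimination -/

/-- By counting dimensions, the derivatives of a rational function satisfy a linear relation whose
coefficients involve only the variable `t`. -/
lemma exists_relation [Nontrivial R] {Q : Module.End R (LaurentFamily R)} (hQ : Q ∈ laurentOps R)
    (hinj : ∀ b ψ, IsBoundedAbove b ψ → Q ψ = 0 → ψ = 0) {b N : ℕ} {H : LaurentFamily R}
    (hb : IsBoundedAbove b H) (hH : IsLaurentPoly N (Q H)) :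
    ∃ (r : ℕ) (c : Fin (r + 1) × (Fin 3 → Fin (r + 1)) → Polynomial R), c ≠ 0 ∧
      ∑ α, (c α : PowerSeries R) • multiDeriv α.1 (fun d => (α.2 d : ℕ)) H = 0 := by
  obtain ⟨δ, hδ⟩ := isLaurentPoly_multiDeriv hQ hH
  obtain ⟨r, hr⟩ : ∃ r, r = (2 * N + 8 * δ + 1) ^ 3 := ⟨_, rfl⟩
  have hpoly : ∀ α : Fin (r + 1) × (Fin 3 → Fin (r + 1)),
      IsLaurentPoly (N + δ * (4 * (r + 1)))
        ((Q ^ (4 * (r + 1) + 1)) (multiDeriv α.1 (fun d => (α.2 d : ℕ)) H)) :=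
    fun α => hδ (r + 1) _ _ α.1.2.le fun d => (α.2 d).2.le
  obtain ⟨M, hM⟩ : ∃ M, M = N + δ * (4 * (r + 1)) := ⟨_, rfl⟩
  rw [← hM] at hpoly
  choose g hg using fun α => (hpoly α).2
  let Φ : (Fin (r + 1) × (Fin 3 → Fin (r + 1)) → Polynomial R) →ₗ[Polynomial R]
      ((Fin 3 → Finset.Icc (-M : ℤ) M) → Polynomial R) :=
    Matrix.mulVecLin (Matrix.of fun p α => g α fun d => (p d : ℤ))
  have hΦ : ¬ Function.Injective Φ := by
    intro hinj
    have hcard := card_le_of_injective (Polynomial R) Φ hinj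
    have h₁ : (M + 1 - -M : ℤ).toNat = 2 * M + 1 := by omega
    simp only [Fintype.card_prod, Fintype.card_fin, Fintype.card_fun, Fintype.card_coe,
      Int.card_Icc, h₁] at hcard
    have h₂ : 2 * M + 1 ≤ (2 * N + 8 * δ + 1) * (r + 1) := by
      rw [hM]
      nlinarith [Nat.zero_le (N * r), Nat.zero_le r]
    have h₃ : (2 * M + 1) ^ 3 ≤ r * (r + 1) ^ 3 := by
      calc (2 * M + 1) ^ 3 ≤ ((2 * N + 8 * δ + 1) * (r + 1)) ^ 3 := Nat.pow_le_pow_left h₂ 3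
        _ = r * (r + 1) ^ 3 := by rw [mul_pow, ← hr]
    have h₄ : 0 < (r + 1) ^ 3 := by positivity
    nlinarith
  rw [injective_iff_map_eq_zero] at hΦ
  push Not at hΦ
  obtain ⟨c, hc, hne⟩ := hΦ
  refine ⟨r, c, hne, pow_apply_eq_zero hQ hinj (4 * (r + 1) + 1)
    (b := b + 3 * (r + 1) + (r + 1)) (IsBoundedAbove.sum _ fun α _ => ?_) ?_⟩
  · refine ((isBoundedAbove_multiDeriv hb _ _).mono ?_).smul _
    have := α.1.2
    have := (α.2 0).2
    have := (α.2 1).2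
    have := (α.2 2).2
    omega
  · rw [map_sum]
    ext1 p
    rw [Finset.sum_apply, Pi.zero_apply]
    simp only [laurentOps_map_smul (pow_mem hQ _), Pi.smul_apply]
    by_cases hp : ∀ d, p d ∈ Finset.Icc (-M : ℤ) M
    · have h := congr_fun hc fun d => ⟨p d, hp d⟩
      simp only [Φ, Matrix.mulVecLin_apply, Matrix.mulVec, dotProduct, Matrix.of_apply,
        Pi.zero_apply] at h
      have h' := congr_arg (Polynomial.coeToPowerSeries.ringHom (R := R)) h
      rw [map_sum, map_zero] at h'
      rw [← h']
      refine Finset.sum_congr rfl fun α _ => ?_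
      rw [map_mul, Polynomial.coeToPowerSeries.ringHom_apply,
        Polynomial.coeToPowerSeries.ringHom_apply, hg, smul_eq_mul]
      exact mul_comm _ _
    · push Not at hp
      obtain ⟨d, hd⟩ := hp
      refine Finset.sum_eq_zero fun α _ => ?_
      rw [(hpoly α).1 p d, smul_zero]
      rw [Finset.mem_Icc, ← abs_le] at hd
      omega

/-- The residue of a rational function in `x, y, z, t` with respect to `x, y, z` is D-finite. -/
theorem residue_dFinite [IsDomain R] [CharZero R] {Q : Module.End R (LaurentFamily R)}
    (hQ : Q ∈ laurentOps R) (hinj : ∀ b ψ, IsBoundedAbove b ψ → Q ψ = 0 → ψ = 0) {b N : ℕ}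
    {H : LaurentFamily R} (hb : IsBoundedAbove b H) (hH : IsLaurentPoly N (Q H)) :
    ∃ (r : ℕ) (c : Fin (r + 1) → Polynomial R), c ≠ 0 ∧
      ∑ m : Fin (r + 1), ((c m : PowerSeries R) *
        (PowerSeries.derivative R)^[(m : ℕ)] (H fun _ => -1)) = 0 := by
  obtain ⟨r, c, hc, hrel⟩ := exists_relation hQ hinj hb hH
  have hfin : {γ : Fin 3 → Fin (r + 1) | ∃ a, c (a, γ) ≠ 0}.Finite := Set.toFinite _
  have hnonempty : {γ : Fin 3 → Fin (r + 1) | ∃ a, c (a, γ) ≠ 0}.Nonempty := by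
    obtain ⟨⟨a, γ⟩, h⟩ := Function.ne_iff.1 hc
    exact ⟨γ, a, h⟩
  obtain ⟨γ, ⟨a₀, ha₀⟩, hmin⟩ := hfin.exists_minimal hnonempty
  refine ⟨r, fun a => c (a, γ), fun h => ha₀ (congr_fun h a₀), ?_⟩
  have h := congr_fun hrel fun d => -((γ d : ℕ) : ℤ) - 1
  have hshift : ((fun d => -((γ d : ℕ) : ℤ) - 1) + fun d => ((γ d : ℕ) : ℤ)) = fun _ => -1 := by
    ext d
    rw [Pi.add_apply]
    ring
  rw [Finset.sum_apply, Fintype.sum_prod_type_right, Finset.sum_eq_single γ] at h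
  · simp only [Pi.smul_apply, multiDeriv_apply, hshift, Pi.zero_apply] at h
    simp_rw [smul_comm _ ((_ : ℤ) : R) (_ : PowerSeries R)] at h
    rw [← Finset.smul_sum] at h
    rw [PowerSeries.smul_eq_C_mul] at h
    refine (mul_eq_zero.1 h).resolve_left ?_
    refine (map_ne_zero_iff _ PowerSeries.C_injective).2 ?_
    exact Int.cast_ne_zero.2 (prod_shift_ne_zero fun d => (γ d : ℕ))
  · intro β _ hβ
    refine Finset.sum_eq_zero fun a _ => ?_
    by_cases hca : c (a, β) = 0
    · simp [hca]
    · have hle : ¬ (fun d => (β d : ℕ)) ≤ fun d => (γ d : ℕ) := fun hle =>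
        hβ (le_antisymm hle (hmin ⟨a, hca⟩ hle))
      rw [Pi.smul_apply, multiDeriv_apply, prod_shift_eq_zero hle, Int.cast_zero, zero_smul,
        smul_zero]
  · intro h
    exact absurd (Finset.mem_univ γ) h

/-! ### Summation of the generating function along one coordinate -/

/-- The expansion of `ψ / (u - x)` in powers of `x / u`, where `u` is the Laurent variable with
index `d`. -/
def tailSum (d : Fin 3) (x : R) (b : ℕ) (ψ : LaurentFamily R) : LaurentFamily R := fun p =>
  PowerSeries.mk fun n => ∑ k ∈ Finset.range (n + b - p d).toNat,
    x ^ k * PowerSeries.coeff n (ψ (p + Pi.single d (k + 1 : ℤ)))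

lemma IsBoundedAbove.tailSum {b : ℕ} {ψ : LaurentFamily R} (h : IsBoundedAbove b ψ) (d : Fin 3)
    (x : R) : IsBoundedAbove b (tailSum d x b ψ) := by
  intro n p e hp
  rw [_root_.tailSum, PowerSeries.coeff_mk]
  refine Finset.sum_eq_zero fun k _ => ?_
  rw [h n _ e, mul_zero]
  rw [Pi.add_apply, Pi.single_apply]
  split_ifs <;> omega

/-- Multiplication by `u - x`, where `u` is the Laurent variable with index `d`. -/
def mulLinear (d : Fin 3) (x : R) : Module.End R (LaurentFamily R) :=
  mulMonomial (Pi.single d 1) - algebraMap R _ x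

lemma mulLinear_mem_laurentOps (d : Fin 3) (x : R) : mulLinear d x ∈ laurentOps R :=
  sub_mem (mulMonomial_mem_laurentOps _) (algebraMap_mem _ x)

lemma coeff_mulLinear (d : Fin 3) (x : R) (ψ : LaurentFamily R) (p : Fin 3 → ℤ) (n : ℕ) :
    PowerSeries.coeff n (mulLinear d x ψ p) =
      PowerSeries.coeff n (ψ (p - Pi.single d 1)) - x * PowerSeries.coeff n (ψ p) := by
  rw [mulLinear, LinearMap.sub_apply, Pi.sub_apply, map_sub, Module.algebraMap_end_apply,
    Pi.smul_apply, map_smul, smul_eq_mul, mulMonomial_apply]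

lemma mulLinear_tailSum {b : ℕ} {ψ : LaurentFamily R} (h : IsBoundedAbove b ψ) (d : Fin 3)
    (x : R) : mulLinear d x (tailSum d x b ψ) = ψ := by
  ext p n
  simp only [coeff_mulLinear, tailSum, PowerSeries.coeff_mk, Pi.sub_apply, Pi.single_eq_same]
  by_cases hp : (n + b : ℤ) < p d
  · rw [show (n + b - (p d - 1) : ℤ).toNat = 0 by omega,
      show (n + b - p d : ℤ).toNat = 0 by omega, h n p d hp]
    simp
  · rw [show (n + b - (p d - 1) : ℤ).toNat = (n + b - p d : ℤ).toNat + 1 by omega,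
      Finset.sum_range_succ', Finset.mul_sum]
    have h₀ : p - Pi.single d 1 + Pi.single d (((0 : ℕ) : ℤ) + 1) = p := by simp
    have h₁ (k : ℕ) : p - Pi.single d 1 + Pi.single d (((k + 1 : ℕ) : ℤ) + 1) =
        p + Pi.single d (k + 1 : ℤ) := by
      push_cast
      rw [Pi.single_add (f := fun _ => ℤ) d ((k : ℤ) + 1) 1]
      abel
    simp only [h₀, h₁, pow_succ', pow_zero, one_mul, mul_assoc]
    abel

lemma eq_zero_of_mulLinear_eq_zero {b : ℕ} {ψ : LaurentFamily R} (h : IsBoundedAbove b ψ)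
    {d : Fin 3} {x : R} (hψ : mulLinear d x ψ = 0) : ψ = 0 := by
  have key (n m : ℕ) : ∀ p : Fin 3 → ℤ, (n + b : ℤ) < p d + m →
      PowerSeries.coeff n (ψ p) = 0 := by
    induction m with
    | zero => exact fun p hp => h n p d (by simpa using hp)
    | succ m ih =>
      intro p hp
      have h₁ := coeff_mulLinear d x ψ (p + Pi.single d 1) n
      rw [hψ, Pi.zero_apply, map_zero, add_sub_cancel_right, ih (p + Pi.single d 1), mul_zero,
        sub_zero] at h₁
      · exact h₁.symm
      · rw [Pi.add_apply, Pi.single_eq_same]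
        push_cast at hp
        omega
  ext p n
  exact key n (n + b - p d + 1).toNat p (by omega)

/-- Multiplication by `1 - t ∑ s ∈ S, u ^ s`. -/
def mulKernel (R : Type*) [CommRing R] (S : Finset (Fin 3 → ℤ)) :
    Module.End R (LaurentFamily R) :=
  1 - mulTime * ∑ s ∈ S, mulMonomial s

lemma mulKernel_mem_laurentOps (S : Finset (Fin 3 → ℤ)) : mulKernel R S ∈ laurentOps R :=
  sub_mem (one_mem _) (mul_mem mulTime_mem_laurentOps
    (sum_mem fun s _ => mulMonomial_mem_laurentOps s))

lemma mulKernel_apply (S : Finset (Fin 3 → ℤ)) (ψ : LaurentFamily R) (p : Fin 3 → ℤ) :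
    mulKernel R S ψ p = ψ p - PowerSeries.X * ∑ s ∈ S, ψ (p - s) := by
  simp [mulKernel, LinearMap.sum_apply, Finset.sum_apply, Finset.mul_sum]

lemma eq_zero_of_mulKernel_eq_zero {S : Finset (Fin 3 → ℤ)} {ψ : LaurentFamily R}
    (h : mulKernel R S ψ = 0) : ψ = 0 := by
  have key (n : ℕ) : ∀ p, PowerSeries.coeff n (ψ p) = 0 := by
    induction n with
    | zero =>
      intro p
      have h₁ := congr_arg (PowerSeries.coeff 0) (congr_fun h p)
      rw [mulKernel_apply, map_sub, PowerSeries.coeff_zero_X_mul, sub_zero] at h₁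
      exact h₁
    | succ n ih =>
      intro p
      have h₁ := congr_arg (PowerSeries.coeff (n + 1)) (congr_fun h p)
      rw [mulKernel_apply, map_sub, PowerSeries.coeff_succ_X_mul, map_sum,
        Finset.sum_eq_zero fun s _ => ih (p - s), sub_zero] at h₁
      exact h₁
  ext p n
  exact key n p

end LaurentOperators

/-! ### The generating function of `S₁` as a residue -/

/-- The generating function of the signed counts. -/
def signedSeries (R : Type*) [CommRing R] : LaurentFamily R := fun p =>
  PowerSeries.mk fun n => (signedCount n (p 0) (p 1) (p 2) : R)

lemma isBoundedAbove_signedSeries (R : Type*) [CommRing R] :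
    IsBoundedAbove 4 (signedSeries R) := by
  intro n p d hp
  rw [signedSeries, PowerSeries.coeff_mk, signedCount_eq_zero_of_lt, Int.cast_zero]
  push_cast at hp
  fin_cases d
  · exact Or.inl hp
  · exact Or.inr (Or.inl hp)
  · exact Or.inr (Or.inr hp)

lemma mulKernel_signedSeries (R : Type*) [CommRing R] (p : Fin 3 → ℤ) :
    mulKernel R S₁ (signedSeries R) p =
      PowerSeries.C (signedCount 0 (p 0) (p 1) (p 2) : R) := by
  ext n
  rw [mulKernel_apply, map_sub]
  cases n with
  | zero => simp [signedSeries]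
  | succ n =>
    rw [PowerSeries.coeff_succ_X_mul, map_sum, PowerSeries.coeff_C, if_neg n.succ_ne_zero]
    simp only [signedSeries, PowerSeries.coeff_mk]
    rw [signedCount_succ_eq_sum, Int.cast_sum, sub_self]

lemma isLaurentPoly_mulKernel_signedSeries (R : Type*) [CommRing R] :
    IsLaurentPoly 4 (mulKernel R S₁ (signedSeries R)) := by
  refine ⟨fun p d hp => ?_, fun p => ⟨Polynomial.C (signedCount 0 (p 0) (p 1) (p 2) : R), ?_⟩⟩
  · rw [mulKernel_signedSeries, signedCount_zero_of_abs, Int.cast_zero, map_zero]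
    push_cast at hp
    fin_cases d
    · exact Or.inl hp
    · exact Or.inr (Or.inl hp)
    · exact Or.inr (Or.inr hp)
  · rw [mulKernel_signedSeries, Polynomial.coe_C]

/-- The rational function in `u` whose residue is `F`. -/
def octantFamily : LaurentFamily (MvPolynomial (Fin 3) ℚ) :=
  tailSum 0 (MvPolynomial.X 0) 4 (tailSum 1 (MvPolynomial.X 1) 4
    (tailSum 2 (MvPolynomial.X 2) 4 (signedSeries _)))

/-- Multiplication by a denominator of `octantFamily`. -/
def octantDenom : Module.End (MvPolynomial (Fin 3) ℚ) (LaurentFamily (MvPolynomial (Fin 3) ℚ)) :=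
  mulKernel _ S₁ * mulLinear 2 (MvPolynomial.X 2) * mulLinear 1 (MvPolynomial.X 1) *
    mulLinear 0 (MvPolynomial.X 0)

lemma octantDenom_mem_laurentOps : octantDenom ∈ laurentOps (MvPolynomial (Fin 3) ℚ) :=
  mul_mem (mul_mem (mul_mem (mulKernel_mem_laurentOps _) (mulLinear_mem_laurentOps _ _))
    (mulLinear_mem_laurentOps _ _)) (mulLinear_mem_laurentOps _ _)

lemma isBoundedAbove_octantFamily : IsBoundedAbove 4 octantFamily :=
  (((isBoundedAbove_signedSeries _).tailSum _ _).tailSum _ _).tailSum _ _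

lemma octantDenom_octantFamily :
    octantDenom octantFamily = mulKernel _ S₁ (signedSeries _) := by
  have h := isBoundedAbove_signedSeries (MvPolynomial (Fin 3) ℚ)
  simp only [octantDenom, octantFamily, Module.End.mul_apply]
  rw [mulLinear_tailSum ((h.tailSum _ _).tailSum _ _), mulLinear_tailSum (h.tailSum _ _),
    mulLinear_tailSum h]

lemma eq_zero_of_octantDenom_eq_zero (b : ℕ) (ψ : LaurentFamily (MvPolynomial (Fin 3) ℚ))
    (hb : IsBoundedAbove b ψ) (h : octantDenom ψ = 0) : ψ = 0 := by
  rw [octantDenom, Module.End.mul_apply, Module.End.mul_apply, Module.End.mul_apply] at h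
  obtain ⟨b₁, h₁⟩ := exists_isBoundedAbove_of_mem_laurentOps
    (mulLinear_mem_laurentOps 0 (MvPolynomial.X 0)) hb
  obtain ⟨b₂, h₂⟩ := exists_isBoundedAbove_of_mem_laurentOps
    (mulLinear_mem_laurentOps 1 (MvPolynomial.X 1)) h₁
  exact eq_zero_of_mulLinear_eq_zero hb <| eq_zero_of_mulLinear_eq_zero h₁ <|
    eq_zero_of_mulLinear_eq_zero h₂ <| eq_zero_of_mulKernel_eq_zero h

lemma octantFamily_residue : (octantFamily fun _ => -1) = F := by
  ext1 n
  have hN : (n + (4 : ℕ) - -1 : ℤ).toNat = n + 5 := by omega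
  have hsub : Finset.range (n + 1) ⊆ Finset.range (n + 5) := Finset.range_subset_range.2 (by omega)
  have hcount (i j k : ℕ) : signedCount n i j k = walkCount S₁ ![(i : ℤ), j, k] n := by
    refine (walkCount_S₁_eq n (p := ![(i : ℤ), j, k]) fun c => ?_).symm
    fin_cases c <;> simp
  have hzero (i j k : ℕ) (h : n < i ∨ n < j ∨ n < k) : signedCount n i j k = 0 := by
    rw [hcount, Nat.cast_eq_zero]
    rcases h with h | h | h
    · exact walkCount_S₁_eq_zero_of_lt (c := 0) (by simpa using h)
    · exact walkCount_S₁_eq_zero_of_lt (c := 1) (by simpa using h)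
    · exact walkCount_S₁_eq_zero_of_lt (c := 2) (by simpa using h)
  simp only [octantFamily, tailSum, signedSeries, F, PowerSeries.coeff_mk, Pi.add_apply, ne_eq,
    Pi.single_eq_same, Pi.single_eq_of_ne, Fin.reduceEq, not_false_eq_true, add_zero, hN,
    neg_add_cancel_comm_assoc]
  have hmem {i : ℕ} (hi : i ∉ Finset.range (n + 1)) : n < i := by
    rw [Finset.mem_range] at hi
    omega
  rw [← Finset.sum_subset hsub fun i _ hi => ?_]
  · refine Finset.sum_congr rfl fun i _ => ?_
    rw [Finset.mul_sum, ← Finset.sum_subset hsub fun j _ hj => ?_]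
    · refine Finset.sum_congr rfl fun j _ => ?_
      rw [Finset.mul_sum, Finset.mul_sum, ← Finset.sum_subset hsub fun k _ hk => ?_]
      · refine Finset.sum_congr rfl fun k _ => ?_
        rw [hcount, Int.cast_natCast, Nat.cast_smul_eq_nsmul, nsmul_eq_mul]
        ring
      · rw [hzero i j k (Or.inr (Or.inr (hmem hk))), Int.cast_zero, mul_zero, mul_zero, mul_zero]
    · rw [Finset.sum_eq_zero fun k _ => ?_, mul_zero, mul_zero]
      rw [hzero i j k (Or.inr (Or.inl (hmem hj))), Int.cast_zero, mul_zero]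
  · rw [Finset.sum_eq_zero fun j _ => ?_, mul_zero]
    rw [Finset.sum_eq_zero fun k _ => ?_, mul_zero]
    rw [hzero i j k (Or.inl (hmem hi)), Int.cast_zero, mul_zero]

/-- The generating function of the model `S₁` is D-finite in `t`: it satisfies
a nontrivial linear differential equation `Σ_{m≤r} c_m (d/dt)^m F = 0` with
polynomial coefficients `c_m ∈ ℚ[x,y,z][t]`. -/
theorem F_S₁_DFinite :
    ∃ (r : ℕ) (c : Fin (r + 1) → Polynomial (MvPolynomial (Fin 3) ℚ)),
      c ≠ 0 ∧
      ∑ m : Fin (r + 1), ((c m : PowerSeries (MvPolynomial (Fin 3) ℚ)) *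
        (PowerSeries.derivativeFun^[(m : ℕ)] F)) = 0 := by
  have hQ : IsLaurentPoly 4 (octantDenom octantFamily) := by
    rw [octantDenom_octantFamily]
    exact isLaurentPoly_mulKernel_signedSeries _
  have h := residue_dFinite octantDenom_mem_laurentOps eq_zero_of_octantDenom_eq_zero
    isBoundedAbove_octantFamily hQ
  rw [octantFamily_residue] at h
  have hderiv : (PowerSeries.derivativeFun (R := MvPolynomial (Fin 3) ℚ)) =
    PowerSeries.derivative (MvPolynomial (Fin 3) ℚ) := rfl
  rw [hderiv]
  exact h
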